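/- For every ε > 0 there exists N such that every tournament T on n ≥ N vertices satisfies t₄(T) ≥ 3/8 − ε. This bound is tight (it is attained in the limit by random tournaments). -/

import Mathlib

open Finset

/-- A tournament: an irreflexive relation such that for distinct vertices exactly one of
`r x y`, `r y x` holds. -/
def IsTournament {V : Type} (r : V → V → Prop) : Prop :=
  (∀ x, ¬ r x x) ∧ ∀ x y : V, x ≠ y → (r x y ↔ ¬ r y x)

/-- The transitive tournament on 4 vertices. -/
def T4rel : Fin 4 → Fin 4 → Prop := fun i j => i < j

/-- The unique strongly connected tournament on 4 vertices. -/
def C4rel : Fin 4 → Fin 4 → Prop := fun i j =>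
  (i = 0 ∧ j = 1) ∨ (i = 1 ∧ j = 2) ∨ (i = 2 ∧ j = 3) ∨ (i = 3 ∧ j = 0) ∨
  (i = 0 ∧ j = 2) ∨ (i = 1 ∧ j = 3)

/-- The 4-vertex tournament in which a cyclic triangle beats a fourth vertex. -/
def W4rel : Fin 4 → Fin 4 → Prop := fun i j =>
  (i = 0 ∧ j = 1) ∨ (i = 1 ∧ j = 2) ∨ (i = 2 ∧ j = 0) ∨
  (i = 0 ∧ j = 3) ∨ (i = 1 ∧ j = 3) ∨ (i = 2 ∧ j = 3)

/-- The 4-vertex tournament in which one vertex beats a cyclic triangle. -/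
def L4rel : Fin 4 → Fin 4 → Prop := fun i j =>
  (i = 0 ∧ j = 1) ∨ (i = 1 ∧ j = 2) ∨ (i = 2 ∧ j = 0) ∨
  (i = 3 ∧ j = 0) ∨ (i = 3 ∧ j = 1) ∨ (i = 3 ∧ j = 2)

/-- The cyclic triangle (directed 3-cycle). -/
def C3rel : Fin 3 → Fin 3 → Prop := fun i j =>
  (i = 0 ∧ j = 1) ∨ (i = 1 ∧ j = 2) ∨ (i = 2 ∧ j = 0)

/-- `s` induces a subtournament isomorphic to the pattern `m`. -/
def InducesPattern {V : Type} {k : ℕ} (r : V → V → Prop) (m : Fin k → Fin k → Prop)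
    (s : Finset V) : Prop :=
  ∃ f : Fin k → V, Function.Injective f ∧ Set.range f = (s : Set V) ∧
    ∀ i j : Fin k, m i j ↔ r (f i) (f j)

-- the number of `k`-element vertex subsets inducing a copy of the pattern `m`
open Classical in
noncomputable def patternCount {V : Type} [Fintype V] {k : ℕ} (r : V → V → Prop)
    (m : Fin k → Fin k → Prop) : ℕ :=
  (((univ : Finset V).powersetCard k).filter (fun s => InducesPattern r m s)).card

-- the probability that a uniformly random `k`-element vertex subset induces a copy of `m`
noncomputable def patternDensity {V : Type} [Fintype V] {k : ℕ} (r : V → V → Prop)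
    (m : Fin k → Fin k → Prop) : ℝ :=
  (patternCount r m : ℝ) / ((Fintype.card V).choose k)

/-! ### Signs and the local polynomial -/

/-- The sum of the signs of a 4-cycle and four times those of a cherry. -/
def HH (a : Fin 4 → Fin 4 → ℤ) : ℤ :=
  a 0 1 * a 1 2 * a 2 3 * a 3 0 + 4 * (a 0 1 * a 0 2)

/-- The Boolean tournament on four vertices with the six given edge directions. -/
def mkB (b01 b02 b03 b12 b13 b23 : Bool) : Fin 4 → Fin 4 → Bool :=
  ![![false, b01, b02, b03], ![!b01, false, b12, b13], ![!b02, !b12, false, b23],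
    ![!b03, !b13, !b23, false]]

/-- The sign matrix of a Boolean relation. -/
def sgB (b : Fin 4 → Fin 4 → Bool) (i j : Fin 4) : ℤ :=
  if b i j then 1 else if b j i then -1 else 0

/-- The four triples of a Boolean tournament are all transitive. -/
def noCyc (b01 b02 b03 b12 b13 b23 : Bool) : Bool :=
  !((b01 == b12 && b12 == !b02) || (b01 == b13 && b13 == !b03) ||
  (b02 == b23 && b23 == !b03) || (b12 == b23 && b23 == !b13))

/-- In-degree in a Boolean tournament. -/
def rankB (b : Fin 4 → Fin 4 → Bool) (i : Fin 4) : ℕ :=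
  (b 0 i).toNat + (b 1 i).toNat + (b 2 i).toNat + (b 3 i).toNat

/-- The twelve even permutations, as functions. -/
def evens : List (Fin 4 → Fin 4) :=
  [![0, 1, 2, 3], ![1, 0, 3, 2], ![2, 3, 0, 1], ![3, 2, 1, 0],
   ![0, 2, 3, 1], ![0, 3, 1, 2], ![1, 2, 0, 3], ![1, 3, 2, 0],
   ![2, 0, 1, 3], ![2, 1, 3, 0], ![3, 0, 2, 1], ![3, 1, 0, 2]]

theorem evens_inj : ∀ v ∈ evens, Function.Injective v := by
  have h : (evens.all fun v => decide (∀ i j, v i = v j → i = j)) = true := by decide +kernel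
  intro v hv i j
  exact of_decide_eq_true (List.all_eq_true.1 h v hv) i j

theorem dec_sum : ∀ b01 b02 b03 b12 b13 b23 : Bool,
    (evens.map fun v => HH (fun i j => sgB (mkB b01 b02 b03 b12 b13 b23) (v i) (v j))).sum =
    32 * (if noCyc b01 b02 b03 b12 b13 b23 then 1 else 0) - 12 := by
  decide +kernel

theorem dec_rank : ∀ b01 b02 b03 b12 b13 b23 : Bool, noCyc b01 b02 b03 b12 b13 b23 = true →
    ∀ i j, rankB (mkB b01 b02 b03 b12 b13 b23) i < 4 ∧
      (rankB (mkB b01 b02 b03 b12 b13 b23) i < rankB (mkB b01 b02 b03 b12 b13 b23) j ↔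
      mkB b01 b02 b03 b12 b13 b23 i j = true) ∧
      (rankB (mkB b01 b02 b03 b12 b13 b23) i = rankB (mkB b01 b02 b03 b12 b13 b23) j → i = j) := by
  decide +kernel

theorem dec_cyc : ∀ b01 b02 b03 b12 b13 b23 : Bool, noCyc b01 b02 b03 b12 b13 b23 = false →
    ∃ i j k, mkB b01 b02 b03 b12 b13 b23 i j = true ∧ mkB b01 b02 b03 b12 b13 b23 j k = true ∧
      mkB b01 b02 b03 b12 b13 b23 k i = true := by
  decide +kernel

theorem noCyc_iff (b01 b02 b03 b12 b13 b23 : Bool) : noCyc b01 b02 b03 b12 b13 b23 = true ↔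
    ∃ σ : Equiv.Perm (Fin 4), ∀ i j : Fin 4,
      (i < j ↔ mkB b01 b02 b03 b12 b13 b23 (σ i) (σ j) = true) := by
  constructor
  · intro h
    have hd := dec_rank _ _ _ _ _ _ h
    let s : Fin 4 → Fin 4 := fun i => ⟨rankB (mkB b01 b02 b03 b12 b13 b23) i, (hd i i).1⟩
    have hs : Function.Injective s := fun i j hij => (hd i j).2.2 (congrArg Fin.val hij)
    let e := Equiv.ofBijective s (Finite.injective_iff_bijective.1 hs)
    refine ⟨e.symm, fun i j => ?_⟩
    rw [← (hd _ _).2.1]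
    have h1 : ∀ i, rankB (mkB b01 b02 b03 b12 b13 b23) (e.symm i) = (i : ℕ) := fun i =>
      congrArg Fin.val (e.apply_symm_apply i)
    rw [h1, h1, Fin.lt_def]
  · rintro ⟨σ, hσ⟩
    by_contra hn
    obtain ⟨i, j, k, h1, h2, h3⟩ := dec_cyc _ _ _ _ _ _ (by simpa using hn)
    have g : ∀ x y, mkB b01 b02 b03 b12 b13 b23 x y = true → σ.symm x < σ.symm y :=
      fun x y h => (hσ _ _).2 (by simpa using h)
    exact lt_irrefl _ ((g _ _ h1).trans ((g _ _ h2).trans (g _ _ h3)))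

open Classical in
/-- The sign matrix of a relation. -/
noncomputable def sg {V : Type} (r : V → V → Prop) (x y : V) : ℤ :=
  if r x y then 1 else if r y x then -1 else 0

theorem induces_iff {V : Type} [DecidableEq V] (r : V → V → Prop) (f : Fin 4 → V)
    (hf : Function.Injective f) :
    InducesPattern r T4rel (univ.image f) ↔
      ∃ σ : Equiv.Perm (Fin 4), ∀ i j : Fin 4, (i < j ↔ r (f (σ i)) (f (σ j))) := by
  constructor
  · rintro ⟨g, hg, hr, h⟩
    have hr' : Set.range g = Set.range f := by simpa using hr
    have : ∀ i, ∃ j, f j = g i := fun i => by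
      have : g i ∈ Set.range f := hr' ▸ Set.mem_range_self i
      exact this
    choose s hs using this
    have hsi : Function.Injective s := fun i j hij => hg (by rw [← hs, ← hs, hij])
    refine ⟨Equiv.ofBijective s (Finite.injective_iff_bijective.1 hsi), fun i j => ?_⟩
    simpa [hs, T4rel] using h i j
  · rintro ⟨σ, h⟩
    refine ⟨f ∘ σ, hf.comp σ.injective, ?_, fun i j => ?_⟩
    · simp [Set.range_comp]
    · simpa [T4rel] using h i j

open Classical in
theorem key_local {V : Type} (r : V → V → Prop) (hr : IsTournament r) (f : Fin 4 → V)
    (hf : Function.Injective f) :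
    (evens.map fun v => HH (fun i j => sg r (f (v i)) (f (v j)))).sum =
    32 * (if InducesPattern r T4rel (univ.image f) then 1 else 0) - 12 := by
  obtain ⟨b01, b02, b03, b12, b13, b23, hb⟩ : ∃ b01 b02 b03 b12 b13 b23 : Bool,
      ∀ i j, r (f i) (f j) ↔ mkB b01 b02 b03 b12 b13 b23 i j = true := by
    have h0 := hr.1
    have h1 : ∀ i j : Fin 4, i ≠ j → (r (f i) (f j) ↔ ¬ r (f j) (f i)) :=
      fun i j h => hr.2 _ _ (hf.ne h)
    refine ⟨decide (r (f 0) (f 1)), decide (r (f 0) (f 2)), decide (r (f 0) (f 3)),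
      decide (r (f 1) (f 2)), decide (r (f 1) (f 3)), decide (r (f 2) (f 3)), fun i j => ?_⟩
    fin_cases i <;> fin_cases j <;> simp [mkB, h0] <;> exact h1 _ _ (by decide)
  have hs : ∀ i j, sg r (f i) (f j) = sgB (mkB b01 b02 b03 b12 b13 b23) i j := by
    intro i j
    simp only [sg, sgB, hb]
  have k := dec_sum b01 b02 b03 b12 b13 b23
  simp only [← hs, noCyc_iff, ← hb] at k
  rw [k]
  simp only [induces_iff r f hf]

/-! ### Summation over injective quadruples -/

open Classical in
/-- The injective quadruples. -/
noncomputable def injs (V : Type) [Fintype V] : Finset (Fin 4 → V) :=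
  univ.filter Function.Injective

theorem card_injs (V : Type) [Fintype V] : (injs V).card = (Fintype.card V).descFactorial 4 := by
  classical
  have := Fintype.card_embedding_eq (α := Fin 4) (β := V)
  rw [Fintype.card_fin] at this
  rw [← this, injs, ← Fintype.card_subtype]
  exact Fintype.card_congr (Equiv.subtypeInjectiveEquivEmbedding _ _)

theorem sum_perm {V : Type} [Fintype V] (F : (Fin 4 → V) → ℤ) (v : Fin 4 → Fin 4)
    (hv : Function.Injective v) :
    ∑ f ∈ injs V, F (f ∘ v) = ∑ f ∈ injs V, F f := by
  classical
  obtain ⟨σ, rfl⟩ : ∃ σ : Equiv.Perm (Fin 4), v = σ :=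
    ⟨Equiv.ofBijective v (Finite.injective_iff_bijective.1 hv), rfl⟩
  refine Finset.sum_equiv (Equiv.arrowCongr σ.symm (Equiv.refl V)) ?_ ?_
  · intro f
    simp only [injs, mem_filter, mem_univ, true_and]
    constructor
    · intro h
      exact h.comp σ.injective
    · intro h
      have h2 : Function.Injective (f ∘ σ) := h
      have := h2.comp σ.symm.injective
      simpa [Function.comp_assoc] using this
  · intro f _
    rfl

open Classical in
theorem fiber_card {V : Type} [Fintype V] (s : Finset V) (hs : s.card = 4) :
    ((injs V).filter (fun f => univ.image f = s)).card = 24 := by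
  have h1 : Fintype.card (Fin 4 ↪ s) = 24 := by
    rw [Fintype.card_embedding_eq, Fintype.card_coe, hs, Fintype.card_fin]; rfl
  rw [← h1, ← Finset.card_univ]
  symm
  refine Finset.card_bij (fun e _ => fun i => (e i : V)) ?_ ?_ ?_
  · intro e _
    have hi : Function.Injective (fun i => (e i : V)) :=
      Subtype.val_injective.comp e.injective
    simp only [injs, mem_filter, mem_univ, true_and]
    refine ⟨hi, ?_⟩
    apply Finset.eq_of_subset_of_card_le
    · intro x hx
      obtain ⟨i, -, rfl⟩ := Finset.mem_image.1 hx
      exact (e i).2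
    · rw [Finset.card_image_of_injective _ hi, hs]; simp
  · intro e _ e' _ h
    ext i
    exact congrFun h i
  · intro f hf
    simp only [injs, mem_filter, mem_univ, true_and] at hf
    obtain ⟨hi, him⟩ := hf
    refine ⟨⟨fun i => ⟨f i, him ▸ Finset.mem_image_of_mem _ (mem_univ _)⟩, ?_⟩, mem_univ _, rfl⟩
    intro i j h
    exact hi (congrArg Subtype.val h)

open Classical in
theorem sum_ind {V : Type} [Fintype V] (p : Finset V → Prop) :
    ∑ f ∈ injs V, (if p (univ.image f) then (1 : ℤ) else 0) =
      24 * ((((univ : Finset V).powersetCard 4).filter p).card : ℤ) := by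
  have hm : ∀ f ∈ injs V, univ.image f ∈ (univ : Finset V).powersetCard 4 := by
    intro f hf
    simp only [injs, mem_filter, mem_univ, true_and] at hf
    rw [Finset.mem_powersetCard]
    exact ⟨subset_univ _, by rw [Finset.card_image_of_injective _ hf]; simp⟩
  rw [← Finset.sum_fiberwise_of_maps_to hm, Finset.card_filter, Nat.cast_sum, Finset.mul_sum]
  refine Finset.sum_congr rfl fun s hs => ?_
  have h4 := fiber_card s (Finset.mem_powersetCard.1 hs).2
  rw [Finset.sum_congr rfl (g := fun _ => if p s then (1 : ℤ) else 0)]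
  · rw [Finset.sum_const, h4]; split_ifs <;> simp
  · intro f hf
    rw [(Finset.mem_filter.1 hf).2]

/-- The local polynomial at a quadruple. -/
noncomputable def HV {V : Type} (r : V → V → Prop) (f : Fin 4 → V) : ℤ :=
  HH (fun i j => sg r (f i) (f j))

theorem main_identity {V : Type} [Fintype V] (r : V → V → Prop) (hr : IsTournament r) :
    64 * (patternCount r T4rel : ℤ) =
      ((Fintype.card V).descFactorial 4 : ℤ) + ∑ f ∈ injs V, HV r f := by
  classical
  have h1 : ∑ f ∈ injs V, (evens.map fun v => HV r (f ∘ v)).sum =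
      12 * ∑ f ∈ injs V, HV r f := by
    have hL : ∀ L : List (Fin 4 → Fin 4), (∀ v ∈ L, Function.Injective v) →
        ∑ f ∈ injs V, (L.map fun v => HV r (f ∘ v)).sum =
          (L.length : ℤ) * ∑ f ∈ injs V, HV r f := by
      intro L
      induction L with
      | nil => simp
      | cons v L ih =>
        intro h
        simp only [List.map_cons, List.sum_cons, Finset.sum_add_distrib, List.length_cons]
        rw [ih (fun w hw => h w (List.mem_cons_of_mem _ hw)),
          sum_perm (HV r) v (h v List.mem_cons_self)]
        push_cast
        ring
    simpa [evens] using hL evens evens_inj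
  have h2 : ∑ f ∈ injs V, (evens.map fun v => HV r (f ∘ v)).sum =
      ∑ f ∈ injs V, (32 * (if InducesPattern r T4rel (univ.image f) then (1 : ℤ) else 0) - 12) := by
    refine Finset.sum_congr rfl fun f hf => ?_
    simp only [injs, mem_filter, mem_univ, true_and] at hf
    rw [← key_local r hr f hf]
    rfl
  rw [Finset.sum_sub_distrib, ← Finset.mul_sum, sum_ind (InducesPattern r T4rel)] at h2
  rw [Finset.sum_const, card_injs, nsmul_eq_mul] at h2
  have h3 : (((univ : Finset V).powersetCard 4).filter (InducesPattern r T4rel)).card =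
      patternCount r T4rel := by
    unfold patternCount
    congr
  rw [h3] at h2
  linarith

/-! ### The lower bound -/

theorem sg_antisymm {V : Type} (r : V → V → Prop) (hr : IsTournament r) (x y : V) :
    sg r x y = - sg r y x := by
  unfold sg
  by_cases h : x = y
  · subst h; simp [hr.1]
  · have := hr.2 x y h
    by_cases h' : r y x <;> simp_all

theorem sg_abs {V : Type} (r : V → V → Prop) (x y : V) : |sg r x y| ≤ 1 := by
  unfold sg
  split_ifs <;> simp

theorem HV_le {V : Type} (r : V → V → Prop) (f : Fin 4 → V) : HV r f ≤ 5 := by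
  have m : ∀ a b : ℤ, |a| ≤ 1 → |b| ≤ 1 → |a * b| ≤ 1 := fun a b ha hb => by
    rw [abs_mul]; exact mul_le_one₀ ha (abs_nonneg _) hb
  have h := fun i j => sg_abs r (f i) (f j)
  have h1 := m _ _ (m _ _ (m _ _ (h 0 1) (h 1 2)) (h 2 3)) (h 3 0)
  have h2 := m _ _ (h 0 1) (h 0 2)
  unfold HV HH
  have := le_abs_self (sg r (f 0) (f 1) * sg r (f 1) (f 2) * sg r (f 2) (f 3) * sg r (f 3) (f 0))
  have := le_abs_self (sg r (f 0) (f 1) * sg r (f 0) (f 2))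
  linarith

/-- Quadruples as functions. -/
def quadEquiv (V : Type) : V × V × V × V ≃ (Fin 4 → V) where
  toFun p := ![p.1, p.2.1, p.2.2.1, p.2.2.2]
  invFun f := (f 0, f 1, f 2, f 3)
  left_inv p := rfl
  right_inv f := by ext i; fin_cases i <;> rfl

theorem sum_all_nonneg {V : Type} [Fintype V] (r : V → V → Prop) (hr : IsTournament r) :
    0 ≤ ∑ f : Fin 4 → V, HV r f := by
  classical
  rw [← (quadEquiv V).sum_comp]
  simp only [Fintype.sum_prod_type]
  have e : ∀ x y z w : V, HV r (quadEquiv V (x, y, z, w)) =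
      sg r x y * sg r y z * (sg r x w * sg r w z) + 4 * (sg r x y * sg r x z) := by
    intro x y z w
    have : HV r (quadEquiv V (x, y, z, w)) =
      sg r x y * sg r y z * sg r z w * sg r w x + 4 * (sg r x y * sg r x z) := rfl
    rw [this, sg_antisymm r hr z w, sg_antisymm r hr w x]
    ring
  simp only [e, Finset.sum_add_distrib]
  apply add_nonneg
  · refine Finset.sum_nonneg fun x _ => ?_
    rw [Finset.sum_comm]
    refine Finset.sum_nonneg fun z _ => ?_
    rw [← Finset.sum_mul_sum]
    exact mul_self_nonneg _
  · refine Finset.sum_nonneg fun x _ => ?_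
    simp only [Finset.sum_const, ← Finset.mul_sum, ← Finset.smul_sum]
    rw [← Finset.sum_mul]
    have := mul_self_nonneg (∑ y, sg r x y)
    positivity

theorem lower_count {V : Type} [Fintype V] (r : V → V → Prop) (hr : IsTournament r) :
    6 * ((Fintype.card V).descFactorial 4 : ℤ) - 5 * (Fintype.card V : ℤ) ^ 4 ≤
      64 * (patternCount r T4rel : ℤ) := by
  classical
  rw [main_identity r hr]
  have h0 := sum_all_nonneg r hr
  have h1 : ∑ f ∈ injs V, (5 - HV r f) ≤ ∑ f : Fin 4 → V, (5 - HV r f) :=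
    Finset.sum_le_sum_of_subset_of_nonneg (subset_univ _)
      (fun f _ _ => sub_nonneg.2 (HV_le r f))
  simp only [Finset.sum_sub_distrib, Finset.sum_const, card_injs, Finset.card_univ,
    Fintype.card_fun, Fintype.card_fin, nsmul_eq_mul] at h1
  push_cast at h1
  linarith

theorem density_eq {V : Type} [Fintype V] (r : V → V → Prop) :
    patternDensity r T4rel =
      24 * (patternCount r T4rel : ℝ) / ((Fintype.card V).descFactorial 4 : ℝ) := by
  unfold patternDensity
  rw [Nat.descFactorial_eq_factorial_mul_choose]
  push_cast
  rw [show ((Nat.factorial 4 : ℕ) : ℝ) = 24 by norm_num [Nat.factorial],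
    mul_div_mul_left _ _ (by norm_num)]

theorem desc_real (n : ℕ) (hn : 6 ≤ n) :
    ((n.descFactorial 4 : ℕ) : ℝ) = n * (n - 1) * (n - 2) * (n - 3) := by
  obtain ⟨k, rfl⟩ := Nat.exists_eq_add_of_le hn
  simp only [Nat.descFactorial]
  rw [show 6 + k - 3 = k + 3 by omega, show 6 + k - 2 = k + 4 by omega,
    show 6 + k - 1 = k + 5 by omega, show 6 + k - 0 = k + 6 by omega]
  push_cast
  ring

theorem lower_bound (ε : ℝ) (hε : 0 < ε) : ∃ N : ℕ, ∀ (V : Type) [Fintype V] (r : V → V → Prop),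
      IsTournament r → N ≤ Fintype.card V → 3 / 8 - ε ≤ patternDensity r T4rel := by
  obtain ⟨K, hK⟩ := exists_nat_gt (180 / ε)
  refine ⟨max 6 K, fun V _ r hr hN => ?_⟩
  have h6 : 6 ≤ Fintype.card V := le_trans (le_max_left _ _) hN
  have hc : K ≤ Fintype.card V := le_trans (le_max_right _ _) hN
  have hl := lower_count r hr
  have hlR : 6 * ((Fintype.card V).descFactorial 4 : ℝ) - 5 * (Fintype.card V : ℝ) ^ 4 ≤
      64 * (patternCount r T4rel : ℝ) := by exact_mod_cast hl
  have hd := desc_real _ h6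
  rw [density_eq]
  generalize (patternCount r T4rel : ℝ) = c at *
  have h6R : (6 : ℝ) ≤ (Fintype.card V : ℝ) := by exact_mod_cast h6
  have hcR : (K : ℝ) ≤ (Fintype.card V : ℝ) := by exact_mod_cast hc
  generalize (Fintype.card V).descFactorial 4 = D' at *
  generalize (D' : ℝ) = D at *
  generalize (Fintype.card V : ℝ) = n at *
  have hεn : 180 ≤ ε * n := by
    rw [div_lt_iff₀ hε] at hK
    nlinarith
  have hD1 : n ^ 4 - 6 * n ^ 3 ≤ D := by
    rw [hd]
    nlinarith [sq_nonneg n]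
  have hD2 : n ^ 4 ≤ 16 * D := by
    have a1 : n / 2 ≤ n - 1 := by linarith
    have a2 : n / 2 ≤ n - 2 := by linarith
    have a3 : n / 2 ≤ n - 3 := by linarith
    have hp : 0 ≤ n / 2 := by linarith
    have b2 : n / 2 * (n / 2) ≤ (n - 1) * (n - 2) :=
      mul_le_mul a1 a2 hp (by linarith)
    have b3 : n / 2 * (n / 2) * (n / 2) ≤ (n - 1) * (n - 2) * (n - 3) :=
      mul_le_mul b2 a3 hp (by nlinarith)
    have b4 := mul_le_mul_of_nonneg_left b3 (by linarith : 0 ≤ n)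
    have hq : 0 ≤ n ^ 4 := by positivity
    rw [hd]
    nlinarith
  have hn4 : 0 < n ^ 4 := by positivity
  have hDpos : 0 < D := by linarith
  rw [le_div_iff₀ hDpos]
  have h3 : 0 ≤ n ^ 3 := by positivity
  have e1 : 180 * n ^ 3 ≤ ε * n * n ^ 3 := mul_le_mul_of_nonneg_right hεn h3
  have e2 : ε * n ^ 4 ≤ ε * (16 * D) := mul_le_mul_of_nonneg_left hD2 hε.le
  nlinarith

/-! ### Tightness: averaging over all tournaments -/

/-- The tournament on `Fin n` coded by a Boolean matrix. -/
def tourOf {n : ℕ} (w : Fin n → Fin n → Bool) (x y : Fin n) : Prop :=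
  (x < y ∧ w x y = true) ∨ (y < x ∧ w y x = false)

theorem tourOf_tour {n : ℕ} (w : Fin n → Fin n → Bool) : IsTournament (tourOf w) := by
  constructor
  · intro x; simp [tourOf]
  · intro x y h
    rcases lt_or_gt_of_ne h with h | h <;> simp [tourOf, h, not_lt.2 h.le]

/-- Reverse the edge between `p` and `q`. -/
def flipEdge {n : ℕ} (p q : Fin n) (w : Fin n → Fin n → Bool) : Fin n → Fin n → Bool :=
  fun x y => if (x = p ∧ y = q) ∨ (x = q ∧ y = p) then !w x y else w x y

theorem flipEdge_flipEdge {n : ℕ} (p q : Fin n) : Function.Involutive (flipEdge p q) := by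
  intro w
  funext x y
  unfold flipEdge
  split_ifs <;> simp

theorem sg_flip_same {n : ℕ} (p q : Fin n) (h : p ≠ q) (w : Fin n → Fin n → Bool) :
    sg (tourOf (flipEdge p q w)) p q = - sg (tourOf w) p q := by
  unfold sg tourOf flipEdge
  rcases lt_or_gt_of_ne h with h | h
  · cases w p q <;> simp [h, not_lt.2 h.le]
  · cases w q p <;> simp [h, not_lt.2 h.le]

theorem sg_flip_other {n : ℕ} (p q x y : Fin n) (h : ¬ ((x = p ∧ y = q) ∨ (x = q ∧ y = p)))
    (w : Fin n → Fin n → Bool) :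
    sg (tourOf (flipEdge p q w)) x y = sg (tourOf w) x y := by
  have h' : ¬ ((y = p ∧ x = q) ∨ (y = q ∧ x = p)) := by tauto
  have e1 : tourOf (flipEdge p q w) x y = tourOf w x y := by
    unfold tourOf flipEdge
    simp only [h, h', if_false]
  have e2 : tourOf (flipEdge p q w) y x = tourOf w y x := by
    unfold tourOf flipEdge
    simp only [h, h', if_false]
  unfold sg
  by_cases c1 : tourOf w x y <;> by_cases c2 : tourOf w y x <;>
    rw [← e1] at c1 <;> rw [← e2] at c2 <;> simp [c1, c2, ← e1, ← e2]

theorem sum_HV_zero {n : ℕ} (f : Fin 4 → Fin n) (hf : Function.Injective f) :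
    ∑ w : Fin n → Fin n → Bool, HV (tourOf w) f = 0 := by
  have h1 : ∀ w, HV (tourOf (flipEdge (f 0) (f 1) w)) f = - HV (tourOf w) f := by
    intro w
    have hs := sg_flip_same (f 0) (f 1) (hf.ne (by decide)) w
    have ho : ∀ i j : Fin 4, ¬ ((i = 0 ∧ j = 1) ∨ (i = 1 ∧ j = 0)) →
        sg (tourOf (flipEdge (f 0) (f 1) w)) (f i) (f j) = sg (tourOf w) (f i) (f j) := by
      intro i j h
      exact sg_flip_other _ _ _ _ (by simpa only [hf.eq_iff] using h) w
    unfold HV HH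
    beta_reduce
    rw [hs, ho 1 2 (by decide), ho 2 3 (by decide), ho 3 0 (by decide), ho 0 2 (by decide)]
    ring
  have h2 := Equiv.sum_comp (flipEdge_flipEdge (f 0) (f 1)).toPerm (fun w => HV (tourOf w) f)
  simp only [Function.Involutive.coe_toPerm, h1, Finset.sum_neg_distrib] at h2
  linarith

theorem upper_exists (n : ℕ) : ∃ r : Fin n → Fin n → Prop,
    IsTournament r ∧ patternDensity r T4rel ≤ 3 / 8 := by
  have hz : ∑ w : Fin n → Fin n → Bool, ∑ f ∈ injs (Fin n), HV (tourOf w) f = 0 := by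
    rw [Finset.sum_comm]
    refine Finset.sum_eq_zero fun f hf => sum_HV_zero f ?_
    simpa [injs] using hf
  obtain ⟨w, -, hw⟩ : ∃ w ∈ (univ : Finset (Fin n → Fin n → Bool)),
      ∑ f ∈ injs (Fin n), HV (tourOf w) f ≤ 0 := by
    by_contra! hcon
    have := Finset.sum_pos hcon univ_nonempty
    omega
  refine ⟨tourOf w, tourOf_tour w, ?_⟩
  have hm := main_identity (tourOf w) (tourOf_tour w)
  have hle : 64 * (patternCount (tourOf w) T4rel : ℤ) ≤
      ((Fintype.card (Fin n)).descFactorial 4 : ℤ) := by linarith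
  have hR : 64 * (patternCount (tourOf w) T4rel : ℝ) ≤
      ((Fintype.card (Fin n)).descFactorial 4 : ℝ) := by exact_mod_cast hle
  rw [density_eq]
  apply div_le_of_le_mul₀ (by positivity) (by norm_num)
  linarith

/-- Every large tournament satisfies `t₄ ≥ 3/8 - ε`, and this bound is tight: there are
arbitrarily large tournaments with `t₄ ≤ 3/8 + ε`. -/
theorem t4_at_least_three_eighths :
    (∀ ε : ℝ, 0 < ε → ∃ N : ℕ, ∀ (V : Type) [Fintype V] (r : V → V → Prop),
      IsTournament r → N ≤ Fintype.card V →
      3 / 8 - ε ≤ patternDensity r T4rel) ∧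
    ∀ ε : ℝ, 0 < ε → ∀ M : ℕ, ∃ n : ℕ, M ≤ n ∧ ∃ r : Fin n → Fin n → Prop,
      IsTournament r ∧ patternDensity r T4rel ≤ 3 / 8 + ε := by
  refine ⟨lower_bound, fun ε hε M => ⟨M, le_rfl, ?_⟩⟩
  obtain ⟨r, hr, h⟩ := upper_exists M
  exact ⟨r, hr, by linarith⟩
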